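/- arXiv:0912.5469 — 2 statements merged into one kernel-verified Lean document; each statement's English description precedes it below -/
import Mathlib

section
/- Let X be a sober topological space and let (Q_j)_{j ∈ J} be a nonempty filtered family of compact saturated subsets of X (filtered means: for all i, j ∈ J there exists k ∈ J with Q_k ⊆ Q_i ∩ Q_j). If ⋂_{j ∈ J} Q_j ⊆ G for some open subset G of X, then there exists j ∈ J with Q_j ⊆ G. -/
open TopologicalSpace Set

/-- A subset of a topological space is saturated if it is an intersection of open sets. -/
def IsSaturatedSet {X : Type*} [TopologicalSpace X] (A : Set X) : Prop :=
  ∃ 𝒰 : Set (Set X), (∀ U ∈ 𝒰, IsOpen U) ∧ A = ⋂₀ 𝒰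

theorem IsSaturatedSet.mem_of_specializes {X : Type*} [TopologicalSpace X] {A : Set X}
    (hA : IsSaturatedSet A) {x y : X} (h : x ⤳ y) (hy : y ∈ A) : x ∈ A := by
  obtain ⟨𝒰, hU, rfl⟩ := hA
  exact fun U hUm => h.mem_open (hU U hUm) (hy U hUm)

/-- A compact set meeting every member of a nonempty chain of closed sets meets the intersection
of the chain. -/
theorem IsCompact.inter_sInter_nonempty_of_isChain {X : Type*} [TopologicalSpace X] {K : Set X}
    (hK : IsCompact K) {c : Set (Set X)} (hc : IsChain (· ⊆ ·) c) (hne : c.Nonempty)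
    (hcl : ∀ C ∈ c, IsClosed C) (hmeet : ∀ C ∈ c, (K ∩ C).Nonempty) : (K ∩ ⋂₀ c).Nonempty := by
  have := hne.to_subtype
  have hc_symm : IsChain (· ⊇ ·) c := hc.symm
  rw [sInter_eq_iInter]
  by_contra h
  obtain ⟨C, hC⟩ := hK.elim_directed_family_closed (fun C : c => (C : Set X))
    (fun C => hcl C C.2) (not_nonempty_iff_eq_empty.mp h) hc_symm.directedOn.directed_val
  exact (hmeet C C.2).ne_empty hC

/-- A closed set that is minimal among the closed sets contained in `F` and meeting every member
of a filtered family is irreducible. -/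
theorem isIrreducible_of_minimal_closed_meeting {X : Type*} [TopologicalSpace X]
    {J : Type*} [Nonempty J] {Q : J → Set X} (hfil : ∀ i j : J, ∃ k : J, Q k ⊆ Q i ∩ Q j)
    {F C : Set X}
    (hC : Minimal (fun C => IsClosed C ∧ C ⊆ F ∧ ∀ j, (Q j ∩ C).Nonempty) C) :
    IsIrreducible C := by
  obtain ⟨hCcl, hCF, hCQ⟩ := hC.prop
  have hmiss : ∀ A, IsClosed A → ¬ C ⊆ A → ∃ j, ¬ (Q j ∩ (C ∩ A)).Nonempty := by
    intro A hA hCA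
    by_contra! h
    exact hCA ((hC.le_of_le ⟨hCcl.inter hA, inter_subset_left.trans hCF, h⟩
      inter_subset_left).trans inter_subset_right)
  refine ⟨(hCQ (Classical.arbitrary J)).right, ?_⟩
  rw [isPreirreducible_iff_isClosed_union_isClosed]
  intro A B hA hB hAB
  by_contra! h
  obtain ⟨i, hi⟩ := hmiss A hA h.1
  obtain ⟨j, hj⟩ := hmiss B hB h.2
  obtain ⟨k, hk⟩ := hfil i j
  obtain ⟨x, hxQ, hxC⟩ := hCQ k
  rcases hAB hxC with hx | hx
  · exact hi ⟨x, (hk hxQ).1, hxC, hx⟩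
  · exact hj ⟨x, (hk hxQ).2, hxC, hx⟩

/-- In a sober space, if the intersection of a nonempty filtered family of compact
saturated subsets is contained in an open set `G`, then some member of the family is
contained in `G`. -/
theorem compactSaturated_iInter_subset_open {X : Type*} [TopologicalSpace X]
    [T0Space X] [QuasiSober X]
    {J : Type*} [Nonempty J] (Q : J → Set X)
    (hfil : ∀ i j : J, ∃ k : J, Q k ⊆ Q i ∩ Q j)
    (hQ : ∀ j : J, IsCompact (Q j) ∧ IsSaturatedSet (Q j))
    (G : Set X) (hG : IsOpen G) (hsub : ⋂ j, Q j ⊆ G) :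
    ∃ j : J, Q j ⊆ G := by
  by_contra! hcon
  obtain ⟨C, -, hC⟩ := zorn_superset_nonempty
    {C : Set X | IsClosed C ∧ C ⊆ Gᶜ ∧ ∀ j, (Q j ∩ C).Nonempty}
    (fun c hcS hc hne => ⟨⋂₀ c,
      ⟨isClosed_sInter fun C hC => (hcS hC).1,
        (sInter_subset_of_mem hne.some_mem).trans (hcS hne.some_mem).2.1,
        fun j => (hQ j).1.inter_sInter_nonempty_of_isChain hc hne
          (fun C hC => (hcS hC).1) fun C hC => (hcS hC).2.2 j⟩,
      fun _ => sInter_subset_of_mem⟩)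
    Gᶜ ⟨hG.isClosed_compl, Subset.rfl, fun j => not_subset.mp (hcon j)⟩
  obtain ⟨hCcl, hCG, hCQ⟩ := hC.prop
  obtain ⟨x, hx⟩ := QuasiSober.sober (isIrreducible_of_minimal_closed_meeting hfil hC) hCcl
  refine hCG hx.mem (hsub (mem_iInter.mpr fun j => ?_))
  obtain ⟨y, hyQ, hyC⟩ := hCQ j
  exact (hQ j).2.mem_of_specializes (hx.specializes hyC) hyQ
end

section
/- Let X be a topological space with sobrification S and sobrification map ξ : X → S, ξ(x) = closure({x}), and let R(X) be the class of subsets R ⊆ X such that R is 0-closed and ξ(R) is compact saturated in S. If (R_j)_{j ∈ J} is a nonempty filtered family of elements of R(X) (for all i, j ∈ J there exists k ∈ J with R_k ⊆ R_i ∩ R_j) and ⋂_{j ∈ J} R_j ⊆ G for some open subset G of X, then there exists j ∈ J with R_j ⊆ G. -/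
open TopologicalSpace Set

/-- The sobrification of a topological space `X`: the set of irreducible closed
subsets of `X`. -/
def Sobrification (X : Type*) [TopologicalSpace X] : Type _ :=
  {C : Set X // IsIrreducible C ∧ IsClosed C}

/-- For an open set `U ⊆ X`, the set `Û = {C ∈ S : C ∩ U ≠ ∅}`. -/
def hatSet {X : Type*} [TopologicalSpace X] (U : Set X) : Set (Sobrification X) :=
  {C | (C.1 ∩ U).Nonempty}

/-- The topology on the sobrification, whose open sets are the sets `Û` for `U` open. -/
instance {X : Type*} [TopologicalSpace X] : TopologicalSpace (Sobrification X) :=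
  TopologicalSpace.generateFrom {s | ∃ U : Set X, IsOpen U ∧ s = hatSet U}

/-- The sobrification map `ξ : X → S`, sending `x` to the closure of `{x}`. -/
def sobrMap {X : Type*} [TopologicalSpace X] (x : X) : Sobrification X :=
  ⟨closure {x}, isIrreducible_singleton.closure, isClosed_closure⟩

/-- A subset `A` of `X` is `0`-closed if whenever `x ∈ A` and `y` has the same
closure as `x`, then `y ∈ A`. -/
def IsZeroClosed {X : Type*} [TopologicalSpace X] (A : Set X) : Prop :=
  ∀ x ∈ A, ∀ y : X, closure {y} = closure ({x} : Set X) → y ∈ A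

/-- The class `R(X)` of `0`-closed subsets whose image under the sobrification map
is compact saturated in the sobrification. -/
def RClass (X : Type*) [TopologicalSpace X] : Set (Set X) :=
  {R | IsZeroClosed R ∧ IsCompact (sobrMap '' R) ∧ IsSaturatedSet (sobrMap '' R)}

/-- For a closed set `F ⊆ X`, the set `τ(F) = {C ∈ S : C ⊆ F}`. -/
def tauSet {X : Type*} [TopologicalSpace X] (F : Set X) : Set (Sobrification X) :=
  {C | C.1 ⊆ F}

section Sobrification

variable {X : Type*} [TopologicalSpace X]

theorem isOpen_hatSet {U : Set X} (hU : IsOpen U) : IsOpen (hatSet U) :=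
  isOpen_generateFrom_of_mem ⟨U, hU, rfl⟩

theorem sobrMap_mem_hatSet {U : Set X} (hU : IsOpen U) {x : X} :
    sobrMap x ∈ hatSet U ↔ x ∈ U := by
  change (closure {x} ∩ U).Nonempty ↔ x ∈ U
  rw [closure_inter_open_nonempty_iff hU, singleton_inter_nonempty]

theorem preimage_sobrMap_hatSet {U : Set X} (hU : IsOpen U) : sobrMap ⁻¹' hatSet U = U :=
  ext fun _ => sobrMap_mem_hatSet hU

theorem exists_eq_hatSet_of_isOpen {V : Set (Sobrification X)} (hV : IsOpen V) :
    ∃ U : Set X, IsOpen U ∧ V = hatSet U := by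
  induction hV with
  | basic s hs => exact hs
  | univ =>
    refine ⟨univ, isOpen_univ, (eq_univ_of_forall fun C => ?_).symm⟩
    simpa [hatSet] using C.2.1.nonempty
  | inter s t _ _ hs ht =>
    obtain ⟨U, hU, rfl⟩ := hs
    obtain ⟨W, hW, rfl⟩ := ht
    refine ⟨U ∩ W, hU.inter hW, ext fun C => ⟨fun h => ?_, fun h => ?_⟩⟩
    · exact C.2.1.isPreirreducible U W hU hW h.1 h.2
    · exact ⟨h.mono (inter_subset_inter_right _ inter_subset_left),
        h.mono (inter_subset_inter_right _ inter_subset_right)⟩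
  | sUnion 𝒱 _ ih =>
    choose! U hU hUV using ih
    refine ⟨⋃ s ∈ 𝒱, U s, isOpen_biUnion hU, ext fun C => ?_⟩
    have hmem : ∀ s ∈ 𝒱, (C ∈ s ↔ (C.1 ∩ U s).Nonempty) := fun s hs => by
      conv_lhs => rw [hUV s hs]
      rfl
    change _ ↔ (C.1 ∩ ⋃ s ∈ 𝒱, U s).Nonempty
    simp only [inter_iUnion₂, nonempty_biUnion, mem_sUnion]
    exact exists_congr fun s => and_congr_right (hmem s)

theorem isInducing_sobrMap : Topology.IsInducing (sobrMap : X → Sobrification X) := by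
  refine ⟨TopologicalSpace.ext_iff.2 fun U => ?_⟩
  rw [isOpen_induced_iff]
  refine ⟨fun hU => ⟨hatSet U, isOpen_hatSet hU, preimage_sobrMap_hatSet hU⟩, ?_⟩
  rintro ⟨V, hV, rfl⟩
  obtain ⟨U, hU, rfl⟩ := exists_eq_hatSet_of_isOpen hV
  rwa [preimage_sobrMap_hatSet hU]

theorem IsSaturatedSet.mem_of_forall_inter_nonempty {R : Set X}
    (hR : IsSaturatedSet (sobrMap '' R)) {C : Sobrification X}
    (hC : ∀ U : Set X, IsOpen U → R ⊆ U → (C.1 ∩ U).Nonempty) : C ∈ sobrMap '' R := by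
  obtain ⟨𝒰, h𝒰, hR𝒰⟩ := hR
  rw [hR𝒰, mem_sInter]
  intro V hV
  have hRV : sobrMap '' R ⊆ V := hR𝒰 ▸ sInter_subset_of_mem hV
  obtain ⟨U, hU, rfl⟩ := exists_eq_hatSet_of_isOpen (h𝒰 V hV)
  refine hC U hU fun x hx => ?_
  exact (sobrMap_mem_hatSet hU).1 (hRV (mem_image_of_mem _ hx))

/-- Among the closed subsets of a closed set `F` meeting every member of a family of compact
sets, there is a minimal one. -/
theorem exists_minimal_isClosed_inter_nonempty {J : Type*} {R : J → Set X}
    (hcomp : ∀ j, IsCompact (R j)) {F : Set X} (hF : IsClosed F)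
    (hFR : ∀ j, (R j ∩ F).Nonempty) :
    ∃ C ⊆ F, Minimal (fun A : Set X => IsClosed A ∧ ∀ j, (R j ∩ A).Nonempty) C := by
  refine zorn_superset_nonempty {A : Set X | IsClosed A ∧ ∀ j, (R j ∩ A).Nonempty}
    (fun c hc hchain hne => ⟨⋂₀ c, ⟨isClosed_sInter fun A hA => (hc hA).1, fun j => ?_⟩,
      fun A hA => sInter_subset_of_mem hA⟩) F ⟨hF, hFR⟩
  by_contra hempty
  have hdir : DirectedOn (· ⊇ ·) c := fun A hA B hB =>
    (hchain.total hA hB).elim (fun h => ⟨A, hA, Subset.rfl, h⟩) fun h => ⟨B, hB, h, Subset.rfl⟩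
  have : Nonempty c := hne.to_subtype
  rw [not_nonempty_iff_eq_empty, sInter_eq_iInter] at hempty
  obtain ⟨A, hA⟩ := (hcomp j).elim_directed_family_closed
    (fun A : c => (A : Set X)) (fun A => (hc A.2).1) hempty hdir.directed_val
  exact ((hc A.2).2 j).ne_empty hA

/-- A minimal closed set meeting every member of a filtered family is irreducible. -/
theorem isIrreducible_of_minimal_isClosed_inter_nonempty {J : Type*} [Nonempty J]
    {R : J → Set X} (hfil : ∀ i j : J, ∃ k : J, R k ⊆ R i ∩ R j) {C : Set X}
    (hC : Minimal (fun A : Set X => IsClosed A ∧ ∀ j, (R j ∩ A).Nonempty) C) :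
    IsIrreducible C := by
  have hdisj : ∀ U : Set X, IsOpen U → (C ∩ U).Nonempty → ∃ j, R j ∩ (C \ U) = ∅ := by
    rintro U hU ⟨x, hxC, hxU⟩
    by_contra! h
    exact (hC.le_of_le ⟨hC.prop.1.sdiff hU, h⟩ sdiff_subset hxC).2 hxU
  refine ⟨(hC.prop.2 (Classical.arbitrary J)).mono inter_subset_right, ?_⟩
  intro U W hU hW hCU hCW
  obtain ⟨i, hi⟩ := hdisj U hU hCU
  obtain ⟨j, hj⟩ := hdisj W hW hCW
  obtain ⟨k, hk⟩ := hfil i j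
  obtain ⟨x, hxk, hxC⟩ := hC.prop.2 k
  refine ⟨x, hxC, by_contra fun hx => ?_, by_contra fun hx => ?_⟩
  · exact eq_empty_iff_forall_notMem.1 hi x ⟨(hk hxk).1, hxC, hx⟩
  · exact eq_empty_iff_forall_notMem.1 hj x ⟨(hk hxk).2, hxC, hx⟩

end Sobrification

/-- If the intersection of a nonempty filtered family of elements of `R(X)` is contained
in an open set `G`, then some member of the family is contained in `G`. -/
theorem RClass_iInter_subset_open (X : Type*) [TopologicalSpace X]
    {J : Type*} [Nonempty J] (R : J → Set X)
    (hfil : ∀ i j : J, ∃ k : J, R k ⊆ R i ∩ R j)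
    (hR : ∀ j : J, R j ∈ RClass X)
    (G : Set X) (hG : IsOpen G) (hsub : ⋂ j, R j ⊆ G) :
    ∃ j : J, R j ⊆ G := by
  by_contra! hG'
  obtain ⟨C, hCG, hC⟩ := exists_minimal_isClosed_inter_nonempty
    (fun j => isInducing_sobrMap.isCompact_iff.2 (hR j).2.1) hG.isClosed_compl
    (fun j => inter_compl_nonempty_iff.2 (hG' j))
  have hmem : ∀ j, ∃ x ∈ R j, closure {x} = C := fun j => by
    obtain ⟨x, hx, hxC⟩ := (hR j).2.2.mem_of_forall_inter_nonempty
      (C := ⟨C, isIrreducible_of_minimal_isClosed_inter_nonempty hfil hC, hC.prop.1⟩)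
      fun U _ hRU => (hC.prop.2 j).mono fun x hx => ⟨hx.2, hRU hx.1⟩
    exact ⟨x, hx, congrArg Subtype.val hxC⟩
  obtain ⟨x, -, hx⟩ := hmem (Classical.arbitrary J)
  refine hCG (hx ▸ subset_closure rfl : x ∈ C) (hsub (mem_iInter.2 fun j => ?_))
  obtain ⟨y, hy, hyC⟩ := hmem j
  exact (hR j).1 y hy x (hx.trans hyC.symm)
end
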